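/- Suppose Assumption P holds: f is C¹, nonincreasing on (−∞,0] and nondecreasing on [0,∞); x ↦ x f'(x)/f(x) is nondecreasing on (−∞,0] and nonincreasing on [0,∞); and ρ_t − η_t > 0 for all t ≥ 0. Then for every time grid and every trade vector ξ ∈ ℝ^{N+1}, C^P(ξ, t) ≥ 0, and for every x ∈ ℝ there is a unique minimizer ξ* of C^P(·, t) over {ξ : Σ_{i=0}^N ξ_i = −x}. It is given as follows: the equation Σ_{i=1}^N λ(t_{i−1})[F(h_{P,i}⁻¹(ν)/a_i) − (λ(t_i)/λ(t_{i−1}))·F(h_{P,i}⁻¹(ν))] + λ(t_N)·F(ν) = −x has a unique solution ν ∈ ℝ, and ξ*_0 = λ(t_0)·F(h_{P,1}⁻¹(ν)/a_1), ξ*_i = λ(t_i)·[F(h_{P,i+1}⁻¹(ν)/a_{i+1}) − F(h_{P,i}⁻¹(ν))] for 1 ≤ i ≤ N−1, ξ*_N = λ(t_N)·[F(ν) − F(h_{P,N}⁻¹(ν))]. The first and last trades satisfy −x·ξ*_0 ≥ 0 and −x·ξ*_N ≥ 0. -/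

import Mathlib

open MeasureTheory Filter

/-- `F(y) = ∫_0^y f(x) dx`. -/
noncomputable def Fint (f : ℝ → ℝ) (y : ℝ) : ℝ := ∫ x in (0:ℝ)..y, f x

/-- `F̃(x) = ∫_0^x y f(y) dy`. -/
noncomputable def Ftil (f : ℝ → ℝ) (x : ℝ) : ℝ := ∫ y in (0:ℝ)..x, y * f y

/-- `G = F̃ ∘ F⁻¹`, where `Finv` plays the role of `F⁻¹`. -/
noncomputable def Gfun (f Finv : ℝ → ℝ) (x : ℝ) : ℝ := Ftil f (Finv x)

/-- `a_i = exp(-∫_{t_{i-1}}^{t_i} ρ_u du)`. -/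
noncomputable def aC (ρ : ℝ → ℝ) (t : ℕ → ℝ) (i : ℕ) : ℝ :=
  Real.exp (-∫ s in (t (i - 1))..(t i), ρ s)

/-- `â_i = a_i · λ(t_i)/λ(t_{i-1})`. -/
noncomputable def aH (ρ lam : ℝ → ℝ) (t : ℕ → ℝ) (i : ℕ) : ℝ :=
  aC ρ t i * lam (t i) / lam (t (i - 1))

/-- Extension of a trade vector `ξ ∈ ℝ^{N+1}` to an `ℕ`-indexed family (zero beyond `N`). -/
def pad {N : ℕ} (ξ : Fin (N + 1) → ℝ) (n : ℕ) : ℝ := if h : n < N + 1 then ξ ⟨n, h⟩ else 0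

/-- The price impact: `D_0 = 0`, `D_n = a_n F⁻¹(ξ_{n-1}/λ(t_{n-1}) + F(D_{n-1}))`. -/
noncomputable def Dpr (f ρ lam Finv : ℝ → ℝ) (t : ℕ → ℝ) (ξ : ℕ → ℝ) : ℕ → ℝ
  | 0 => 0
  | n + 1 => aC ρ t (n + 1) * Finv (ξ n / lam (t n) + Fint f (Dpr f ρ lam Finv t ξ n))

/-- The model-P cost `C^P(ξ, t) = Σ_{n=0}^N λ(t_n) [G(F(D_n) + ξ_n/λ(t_n)) − G(F(D_n))]`. -/
noncomputable def CPg (f ρ lam Finv : ℝ → ℝ) (N : ℕ) (t : ℕ → ℝ)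
    (ξ : Fin (N + 1) → ℝ) : ℝ :=
  ∑ n ∈ Finset.range (N + 1),
    lam (t n) * (Gfun f Finv (Fint f (Dpr f ρ lam Finv t (pad ξ) n) + pad ξ n / lam (t n)) -
      Gfun f Finv (Fint f (Dpr f ρ lam Finv t (pad ξ) n)))

/-- `h_{P,i}(x) = x [(1/a_i) f(x/a_i) − â_i f(x)] / [f(x/a_i) − â_i f(x)]`. -/
noncomputable def hP (f ρ lam : ℝ → ℝ) (t : ℕ → ℝ) (i : ℕ) (x : ℝ) : ℝ :=
  x * ((1 / aC ρ t i) * f (x / aC ρ t i) - aH ρ lam t i * f x) /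
    (f (x / aC ρ t i) - aH ρ lam t i * f x)


/-- The map `h_{P,i}` for a single trading period, with `a = a_i` and `b = â_i`. -/
noncomputable def hPeriod (f : ℝ → ℝ) (a b x : ℝ) : ℝ :=
  x * ((1 / a) * f (x / a) - b * f x) / (f (x / a) - b * f x)

theorem Fint_zero (f : ℝ → ℝ) : Fint f 0 = 0 := by simp [Fint]

theorem Ftil_zero (f : ℝ → ℝ) : Ftil f 0 = 0 := by simp [Ftil]

theorem hasDerivAt_Fint {f : ℝ → ℝ} (hf : Continuous f) (x : ℝ) :
    HasDerivAt (Fint f) (f x) x :=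
  (hf.integral_hasStrictDerivAt 0 x).hasDerivAt

theorem hasDerivAt_Ftil {f : ℝ → ℝ} (hf : Continuous f) (x : ℝ) :
    HasDerivAt (Ftil f) (x * f x) x :=
  ((continuous_id.mul hf).integral_hasStrictDerivAt 0 x).hasDerivAt

theorem strictMono_Fint {f : ℝ → ℝ} (hf : Continuous f) (hfpos : ∀ x, 0 < f x) :
    StrictMono (Fint f) :=
  strictMono_of_deriv_pos fun x => by rw [(hasDerivAt_Fint hf x).deriv]; exact hfpos x

theorem HasDerivAt.comp_div_const {u : ℝ → ℝ} {u' x a : ℝ} (hu : HasDerivAt u u' (x / a)) :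
    HasDerivAt (fun z => u (z / a)) (u' * (1 / a)) x :=
  HasDerivAt.comp (h₂ := u) (h := fun z => z / a) x hu ((hasDerivAt_id x).div_const a)

/-- A function with derivative `(h - ν) p`, where `p > 0` and `h` is strictly increasing, has a
strict global minimum where `h = ν`. -/
theorem lt_of_hasDerivAt_sub_mul {u h p : ℝ → ℝ} {ν z e : ℝ} (hh : StrictMono h)
    (hp : ∀ x, 0 < p x) (hu : ∀ x, HasDerivAt u ((h x - ν) * p x) x) (hz : h z = ν)
    (hne : e ≠ z) : u z < u e := by
  have hc : Continuous u := continuous_iff_continuousAt.2 fun x => (hu x).continuousAt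
  rcases lt_or_gt_of_ne hne with hlt | hlt
  · have : StrictAntiOn u (Set.Iic z) := by
      refine strictAntiOn_of_deriv_neg (convex_Iic z) hc.continuousOn fun x hx => ?_
      rw [interior_Iic] at hx
      rw [(hu x).deriv, ← hz]
      exact mul_neg_of_neg_of_pos (sub_neg.2 (hh hx)) (hp x)
    exact this hlt.le Set.self_mem_Iic hlt
  · have : StrictMonoOn u (Set.Ici z) := by
      refine strictMonoOn_of_deriv_pos (convex_Ici z) hc.continuousOn fun x hx => ?_
      rw [interior_Ici] at hx
      rw [(hu x).deriv, ← hz]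
      exact mul_pos (sub_pos.2 (hh hx)) (hp x)
    exact this Set.self_mem_Ici hlt.le hlt

theorem le_of_hasDerivAt_sub_mul {u h p : ℝ → ℝ} {ν z : ℝ} (hh : StrictMono h)
    (hp : ∀ x, 0 < p x) (hu : ∀ x, HasDerivAt u ((h x - ν) * p x) x) (hz : h z = ν)
    (e : ℝ) : u z ≤ u e := by
  rcases eq_or_ne e z with rfl | hne
  · exact le_rfl
  · exact (lt_of_hasDerivAt_sub_mul hh hp hu hz hne).le

section Period

variable {f : ℝ → ℝ} {a b : ℝ}

theorem le_comp_div (hfanti : AntitoneOn f (Set.Iic 0)) (hfmono : MonotoneOn f (Set.Ici 0))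
    (ha : 0 < a) (ha1 : a < 1) (x : ℝ) : f x ≤ f (x / a) := by
  rcases le_total 0 x with hx | hx
  · exact hfmono hx (div_nonneg hx ha.le) (by rw [le_div_iff₀ ha]; nlinarith)
  · exact hfanti (div_nonpos_of_nonpos_of_nonneg hx ha.le) hx
      (by rw [div_le_iff₀ ha]; nlinarith)

theorem period_denom_pos (hfpos : ∀ x, 0 < f x) (hfanti : AntitoneOn f (Set.Iic 0))
    (hfmono : MonotoneOn f (Set.Ici 0)) (ha : 0 < a) (ha1 : a < 1) (hb1 : b < 1) (x : ℝ) :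
    0 < f (x / a) - b * f x := by
  have := le_comp_div hfanti hfmono ha ha1 x
  nlinarith [hfpos x]

theorem hasDerivAt_ratio (hf : ContDiff ℝ 1 f) (hfpos : ∀ x, 0 < f x) (ha : 0 < a) {x : ℝ}
    (hx : x ≠ 0) :
    HasDerivAt (fun y => f (y / a) / f y)
      (f (x / a) / f x *
        (((x / a) * deriv f (x / a) / f (x / a) - x * deriv f x / f x) / x)) x := by
  have hd : ∀ y, HasDerivAt f (deriv f y) y := fun y =>
    (hf.differentiable one_ne_zero y).hasDerivAt
  have h1 : HasDerivAt (fun y => f (y / a)) (deriv f (x / a) * (1 / a)) x :=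
    (hd (x / a)).comp_div_const
  refine (h1.fun_div (hd x) (hfpos x).ne').congr_deriv ?_
  have := (hfpos x).ne'
  have := (hfpos (x / a)).ne'
  field_simp

theorem antitoneOn_ratio (hf : ContDiff ℝ 1 f) (hfpos : ∀ x, 0 < f x)
    (hr2 : AntitoneOn (fun x => x * deriv f x / f x) (Set.Ici 0)) (ha : 0 < a) (ha1 : a < 1) :
    AntitoneOn (fun y => f (y / a) / f y) (Set.Ici 0) := by
  have hfc := hf.continuous
  refine antitoneOn_of_hasDerivWithinAt_nonpos (convex_Ici 0)
    (Continuous.continuousOn ?_) (fun x hx => ?_) (fun x hx => ?_)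
    (f' := fun x => f (x / a) / f x *
      (((x / a) * deriv f (x / a) / f (x / a) - x * deriv f x / f x) / x))
  · exact (hfc.comp (continuous_id.div_const a)).div hfc fun x => (hfpos x).ne'
  · rw [interior_Ici] at hx
    exact (hasDerivAt_ratio hf hfpos ha (ne_of_gt hx)).hasDerivWithinAt
  · rw [interior_Ici, Set.mem_Ioi] at hx
    refine mul_nonpos_of_nonneg_of_nonpos (div_pos (hfpos _) (hfpos _)).le
      (div_nonpos_of_nonpos_of_nonneg (sub_nonpos.2 ?_) hx.le)
    exact hr2 hx.le (div_pos hx ha).le (by rw [le_div_iff₀ ha]; nlinarith)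

theorem monotoneOn_ratio (hf : ContDiff ℝ 1 f) (hfpos : ∀ x, 0 < f x)
    (hr1 : MonotoneOn (fun x => x * deriv f x / f x) (Set.Iic 0)) (ha : 0 < a) (ha1 : a < 1) :
    MonotoneOn (fun y => f (y / a) / f y) (Set.Iic 0) := by
  have hfc := hf.continuous
  refine monotoneOn_of_hasDerivWithinAt_nonneg (convex_Iic 0)
    (Continuous.continuousOn ?_) (fun x hx => ?_) (fun x hx => ?_)
    (f' := fun x => f (x / a) / f x *
      (((x / a) * deriv f (x / a) / f (x / a) - x * deriv f x / f x) / x))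
  · exact (hfc.comp (continuous_id.div_const a)).div hfc fun x => (hfpos x).ne'
  · rw [interior_Iic] at hx
    exact (hasDerivAt_ratio hf hfpos ha (ne_of_lt hx)).hasDerivWithinAt
  · rw [interior_Iic, Set.mem_Iio] at hx
    refine mul_nonneg (div_pos (hfpos _) (hfpos _)).le
      (div_nonneg_of_nonpos (sub_nonpos.2 ?_) hx.le)
    exact hr1 (div_neg_of_neg_of_pos hx ha).le hx.le (by rw [div_le_iff₀ ha]; nlinarith)

/-- The slope `h(x) / x` expressed through the ratio `f(x/a) / f(x)`. -/
theorem hPeriod_eq (hfpos : ∀ x, 0 < f x) (ha : 0 < a)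
    (hden : ∀ x, 0 < f (x / a) - b * f x) (x : ℝ) :
    hPeriod f a b x = x * (1 / a + b * (1 / a - 1) / (f (x / a) / f x - b)) := by
  have h1 := (hfpos x).ne'
  have h2 := (hden x).ne'
  have h3 : f (x / a) / f x - b ≠ 0 := by
    have : f (x / a) / f x - b = (f (x / a) - b * f x) / f x := by field_simp
    rw [this]; exact div_ne_zero h2 h1
  have h4 : f (x / a) / f x - b = (f (x / a) - b * f x) / f x := by field_simp
  rw [h4, hPeriod]
  field_simp
  ring

theorem hPeriod_zero : hPeriod f a b 0 = 0 := by simp [hPeriod]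

theorem strictMono_hPeriod (hf : ContDiff ℝ 1 f) (hfpos : ∀ x, 0 < f x)
    (hr1 : MonotoneOn (fun x => x * deriv f x / f x) (Set.Iic 0))
    (hr2 : AntitoneOn (fun x => x * deriv f x / f x) (Set.Ici 0))
    (ha : 0 < a) (ha1 : a < 1) (hb : 0 < b) (hden : ∀ x, 0 < f (x / a) - b * f x) :
    StrictMono (hPeriod f a b) := by
  have hk : ∀ x, 0 < f (x / a) / f x - b := fun x => by
    have : f (x / a) / f x - b = (f (x / a) - b * f x) / f x := by
      have := (hfpos x).ne'
      field_simp
    rw [this]; exact div_pos (hden x) (hfpos x)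
  have hia : 1 < 1 / a := by rw [lt_div_iff₀ ha]; linarith
  have hc : 0 < b * (1 / a - 1) := mul_pos hb (by linarith)
  have hg : ∀ x, 0 < 1 / a + b * (1 / a - 1) / (f (x / a) / f x - b) := fun x => by
    have := div_pos hc (hk x)
    linarith
  have hgle : ∀ x y, f (y / a) / f y ≤ f (x / a) / f x →
      1 / a + b * (1 / a - 1) / (f (x / a) / f x - b) ≤
        1 / a + b * (1 / a - 1) / (f (y / a) / f y - b) := fun x y hxy => by
    have := div_le_div_of_nonneg_left hc.le (hk y) (sub_le_sub_right hxy b)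
    linarith
  have hpos : StrictMonoOn (hPeriod f a b) (Set.Ici 0) := by
    intro x hx y hy hxy
    rw [hPeriod_eq hfpos ha hden, hPeriod_eq hfpos ha hden]
    exact (mul_le_mul_of_nonneg_left
      (hgle x y (antitoneOn_ratio hf hfpos hr2 ha ha1 hx hy hxy.le)) hx).trans_lt
      (mul_lt_mul_of_pos_right hxy (hg y))
  have hneg : StrictMonoOn (hPeriod f a b) (Set.Iic 0) := by
    intro x hx y hy hxy
    rw [hPeriod_eq hfpos ha hden, hPeriod_eq hfpos ha hden]
    exact (mul_lt_mul_of_pos_right hxy (hg x)).trans_le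
      (mul_le_mul_of_nonpos_left
      (hgle y x (monotoneOn_ratio hf hfpos hr1 ha ha1 hx hy hxy.le)) hy)
  exact hneg.Iic_union_Ici hpos

theorem continuous_hPeriod (hf : Continuous f) (hden : ∀ x, 0 < f (x / a) - b * f x) :
    Continuous (hPeriod f a b) := by
  have h1 : Continuous fun x => f (x / a) := hf.comp (continuous_id.div_const a)
  exact (continuous_id.mul ((continuous_const.mul h1).sub (continuous_const.mul hf))).div
    (h1.sub (continuous_const.mul hf)) fun x => (hden x).ne'

theorem hPeriod_sub_self (ha : 0 < a) (hden : ∀ x, 0 < f (x / a) - b * f x) (x : ℝ) :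
    hPeriod f a b x - x = x * ((1 / a - 1) * f (x / a) / (f (x / a) - b * f x)) := by
  have := (hden x).ne'
  rw [hPeriod]
  field_simp
  ring

theorem slope_factor_nonneg (hfpos : ∀ x, 0 < f x) (ha : 0 < a) (ha1 : a < 1)
    (hden : ∀ x, 0 < f (x / a) - b * f x) (x : ℝ) :
    0 ≤ (1 / a - 1) * f (x / a) / (f (x / a) - b * f x) := by
  have hia : 1 ≤ 1 / a := by rw [le_div_iff₀ ha]; linarith
  exact div_nonneg (mul_nonneg (by linarith) (hfpos _).le) (hden x).le

theorem le_hPeriod (hfpos : ∀ x, 0 < f x) (ha : 0 < a) (ha1 : a < 1)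
    (hden : ∀ x, 0 < f (x / a) - b * f x) {x : ℝ} (hx : 0 ≤ x) : x ≤ hPeriod f a b x := by
  rw [← sub_nonneg, hPeriod_sub_self ha hden]
  exact mul_nonneg hx (slope_factor_nonneg hfpos ha ha1 hden x)

theorem hPeriod_le (hfpos : ∀ x, 0 < f x) (ha : 0 < a) (ha1 : a < 1)
    (hden : ∀ x, 0 < f (x / a) - b * f x) {x : ℝ} (hx : x ≤ 0) : hPeriod f a b x ≤ x := by
  rw [← sub_nonpos, hPeriod_sub_self ha hden]
  exact mul_nonpos_of_nonpos_of_nonneg hx (slope_factor_nonneg hfpos ha ha1 hden x)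

theorem surjective_hPeriod (hf : Continuous f) (hfpos : ∀ x, 0 < f x) (ha : 0 < a)
    (ha1 : a < 1) (hden : ∀ x, 0 < f (x / a) - b * f x) :
    Function.Surjective (hPeriod f a b) := by
  refine (continuous_hPeriod hf hden).surjective
    (tendsto_atTop_mono' _ ?_ tendsto_id) (tendsto_atBot_mono' _ ?_ tendsto_id)
  · filter_upwards [eventually_ge_atTop 0] with x hx using le_hPeriod hfpos ha ha1 hden hx
  · filter_upwards [eventually_le_atBot 0] with x hx using hPeriod_le hfpos ha ha1 hden hx

theorem hasDerivAt_volume (hf : Continuous f) (ha : 0 < a) (c x : ℝ) :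
    HasDerivAt (fun z => Fint f (z / a) - c * Fint f z)
      ((1 / a) * (f (x / a) - a * c * f x)) x := by
  have h1 : HasDerivAt (fun z => Fint f (z / a)) (f (x / a) * (1 / a)) x :=
    (hasDerivAt_Fint hf (x / a)).comp_div_const
  refine (h1.fun_sub ((hasDerivAt_Fint hf x).const_mul c)).congr_deriv ?_
  field_simp

theorem strictMono_volume (hf : Continuous f) (ha : 0 < a) {c : ℝ}
    (hden : ∀ x, 0 < f (x / a) - a * c * f x) :
    StrictMono (fun z => Fint f (z / a) - c * Fint f z) :=
  strictMono_of_deriv_pos fun x => by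
    rw [(hasDerivAt_volume hf ha c x).deriv]
    exact mul_pos (one_div_pos.2 ha) (hden x)

theorem hasDerivAt_lagrangian (hf : Continuous f) (ha : 0 < a) {c : ℝ}
    (hden : ∀ x, 0 < f (x / a) - a * c * f x) (ν x : ℝ) :
    HasDerivAt (fun z => Ftil f (z / a) - c * Ftil f z - ν * (Fint f (z / a) - c * Fint f z))
      ((hPeriod f a (a * c) x - ν) * ((1 / a) * (f (x / a) - a * c * f x))) x := by
  have h1 : HasDerivAt (fun z => Ftil f (z / a)) (x / a * f (x / a) * (1 / a)) x :=
    (hasDerivAt_Ftil hf (x / a)).comp_div_const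
  refine ((h1.fun_sub ((hasDerivAt_Ftil hf x).const_mul c)).fun_sub
    ((hasDerivAt_volume hf ha c x).const_mul ν)).congr_deriv ?_
  have := (hden x).ne'
  rw [hPeriod]
  field_simp

theorem hasDerivAt_terminal_lagrangian (hf : Continuous f) (ν x : ℝ) :
    HasDerivAt (fun z => Ftil f z - ν * Fint f z) ((id x - ν) * f x) x := by
  refine ((hasDerivAt_Ftil hf x).fun_sub
    ((hasDerivAt_Fint hf x).const_mul ν)).congr_deriv ?_
  simp only [id]
  ring

end Period

section Coefficients

variable {ρ lam : ℝ → ℝ} {t : ℕ → ℝ} {i : ℕ}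

theorem aC_pos : 0 < aC ρ t i := Real.exp_pos _

theorem aC_lt_one (hρ : Continuous ρ) (hρpos : ∀ s, 0 ≤ s → 0 < ρ s)
    (h0 : 0 ≤ t (i - 1)) (hlt : t (i - 1) < t i) : aC ρ t i < 1 := by
  rw [aC, Real.exp_lt_one_iff, neg_lt_zero]
  exact intervalIntegral.intervalIntegral_pos_of_pos_on (hρ.intervalIntegrable _ _)
    (fun s hs => hρpos s (h0.trans hs.1.le)) hlt

theorem aH_lt_one (hρ : Continuous ρ) (hlam : Differentiable ℝ lam)
    (hlampos : ∀ s, 0 ≤ s → 0 < lam s) (hres : ∀ s, 0 ≤ s → deriv lam s / lam s < ρ s)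
    (h0 : 0 ≤ t (i - 1)) (hlt : t (i - 1) < t i) : aH ρ lam t i < 1 := by
  have hd : ∀ s, HasDerivAt (fun r => Real.exp (-∫ u in (t (i - 1))..r, ρ u) * lam r)
      (Real.exp (-∫ u in (t (i - 1))..s, ρ u) * (deriv lam s - ρ s * lam s)) s := fun s => by
    refine (((hρ.integral_hasStrictDerivAt (t (i - 1)) s).hasDerivAt.fun_neg.exp).fun_mul
      (hlam s).hasDerivAt).congr_deriv ?_
    ring
  have hanti : StrictAntiOn (fun r => Real.exp (-∫ u in (t (i - 1))..r, ρ u) * lam r)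
      (Set.Icc (t (i - 1)) (t i)) := by
    refine strictAntiOn_of_deriv_neg (convex_Icc _ _)
      (fun s _ => (hd s).continuousAt.continuousWithinAt) fun s hs => ?_
    rw [interior_Icc] at hs
    have hs0 : 0 ≤ s := h0.trans hs.1.le
    rw [(hd s).deriv]
    have := hres s hs0
    rw [div_lt_iff₀ (hlampos s hs0)] at this
    exact mul_neg_of_pos_of_neg (Real.exp_pos _) (by linarith)
  have := hanti (Set.left_mem_Icc.2 hlt.le) (Set.right_mem_Icc.2 hlt.le) hlt
  rw [aH, div_lt_one (hlampos _ h0), aC]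
  simpa using this

end Coefficients

/-- The price impact right after the `n`-th trade. -/
noncomputable def postImpact (f ρ lam Finv : ℝ → ℝ) (t : ℕ → ℝ) (ξ : ℕ → ℝ) (n : ℕ) : ℝ :=
  Finv (Fint f (Dpr f ρ lam Finv t ξ n) + ξ n / lam (t n))

/-- The aggregate of `K` over all periods in terms of the impacts `z i` just before the trades
`1 ≤ i ≤ N` and the final impact `e`; it gives the traded volume for `K = F` and the cost for
`K = F̃`. -/
noncomputable def periodSum (ρ lam : ℝ → ℝ) (t : ℕ → ℝ) (N : ℕ) (K : ℝ → ℝ) (z : ℕ → ℝ)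
    (e : ℝ) : ℝ :=
  ∑ i ∈ Finset.range N, lam (t i) * (K (z (i + 1) / aC ρ t (i + 1)) -
    lam (t (i + 1)) / lam (t i) * K (z (i + 1))) + lam (t N) * K e

theorem sum_Icc_one_eq_sum_range (φ : ℕ → ℝ) (N : ℕ) :
    ∑ i ∈ Finset.Icc 1 N, φ i = ∑ i ∈ Finset.range N, φ (i + 1) := by
  induction N with
  | zero => simp
  | succ n ih => rw [Finset.sum_Icc_succ_top (by omega), ih, Finset.sum_range_succ]

theorem sum_univ_eq_sum_pad {N : ℕ} (ξ : Fin (N + 1) → ℝ) :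
    ∑ i, ξ i = ∑ n ∈ Finset.range (N + 1), pad ξ n := by
  rw [← Fin.sum_univ_eq_sum_range]
  exact Finset.sum_congr rfl fun i _ => by rw [pad, dif_pos i.2]

theorem sum_mul_sub_eq_periodSum {ρ lam : ℝ → ℝ} {t : ℕ → ℝ} {N : ℕ} {K : ℝ → ℝ}
    {E D : ℕ → ℝ} (hK : K (D 0) = 0) (hl : ∀ n ≤ N, lam (t n) ≠ 0)
    (hD : ∀ n < N, D (n + 1) = aC ρ t (n + 1) * E n) :
    ∑ n ∈ Finset.range (N + 1), lam (t n) * (K (E n) - K (D n)) =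
      periodSum ρ lam t N K D (E N) := by
  induction N with
  | zero => simp [periodSum, hK]
  | succ n ih =>
    rw [Finset.sum_range_succ, ih (fun m hm => hl m (by omega)) fun m hm => hD m (by omega),
      periodSum, periodSum, Finset.sum_range_succ, hD n (by omega),
      mul_div_cancel_left₀ _ aC_pos.ne']
    have := hl n (by omega)
    field_simp
    ring

section Dynamics

variable {f ρ lam Finv : ℝ → ℝ} {t : ℕ → ℝ} {N : ℕ}

theorem Dpr_succ (ξ : ℕ → ℝ) (n : ℕ) :
    Dpr f ρ lam Finv t ξ (n + 1) = aC ρ t (n + 1) * postImpact f ρ lam Finv t ξ n := by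
  rw [postImpact, Dpr, add_comm (ξ n / lam (t n))]

theorem trade_eq (hFinv1 : ∀ y, Fint f (Finv y) = y) (ξ : ℕ → ℝ) {n : ℕ}
    (hl : lam (t n) ≠ 0) :
    ξ n = lam (t n) * (Fint f (postImpact f ρ lam Finv t ξ n) -
      Fint f (Dpr f ρ lam Finv t ξ n)) := by
  rw [postImpact, hFinv1]
  field_simp
  ring

theorem postImpact_eq (hFinv2 : ∀ y, Finv (Fint f y) = y) {ξ : ℕ → ℝ} {n : ℕ} {w : ℝ}
    (hl : lam (t n) ≠ 0)
    (hξ : ξ n = lam (t n) * (Fint f w - Fint f (Dpr f ρ lam Finv t ξ n))) :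
    postImpact f ρ lam Finv t ξ n = w := by
  rw [postImpact, hξ, mul_div_cancel_left₀ _ hl, add_sub_cancel, hFinv2]

theorem Dpr_eq (hFinv2 : ∀ y, Finv (Fint f y) = y) (hl : ∀ n ≤ N, lam (t n) ≠ 0)
    {ξ z : ℕ → ℝ} (hz : z 0 = 0)
    (hξ : ∀ n < N, ξ n =
      lam (t n) * (Fint f (z (n + 1) / aC ρ t (n + 1)) - Fint f (z n))) :
    ∀ n ≤ N, Dpr f ρ lam Finv t ξ n = z n := by
  intro n
  induction n with
  | zero => intro _; rw [Dpr, hz]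
  | succ n ih =>
    intro hn
    rw [Dpr_succ, postImpact_eq hFinv2 (hl n (by omega)) (by rw [ih (by omega), hξ n (by omega)]),
      mul_div_cancel₀ _ aC_pos.ne']

theorem CPg_eq_periodSum (hFinv2 : ∀ y, Finv (Fint f y) = y) (hl : ∀ n ≤ N, lam (t n) ≠ 0)
    (ξ : Fin (N + 1) → ℝ) :
    CPg f ρ lam Finv N t ξ = periodSum ρ lam t N (Ftil f) (Dpr f ρ lam Finv t (pad ξ))
      (postImpact f ρ lam Finv t (pad ξ) N) := by
  rw [← sum_mul_sub_eq_periodSum (E := postImpact f ρ lam Finv t (pad ξ))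
    (by rw [Dpr, Ftil_zero]) hl fun n _ => Dpr_succ _ n]
  simp only [CPg, Gfun, hFinv2, postImpact]

theorem sum_eq_periodSum (hFinv1 : ∀ y, Fint f (Finv y) = y) (hl : ∀ n ≤ N, lam (t n) ≠ 0)
    (ξ : Fin (N + 1) → ℝ) :
    ∑ i, ξ i = periodSum ρ lam t N (Fint f) (Dpr f ρ lam Finv t (pad ξ))
      (postImpact f ρ lam Finv t (pad ξ) N) := by
  rw [← sum_mul_sub_eq_periodSum (E := postImpact f ρ lam Finv t (pad ξ))
    (by rw [Dpr, Fint_zero]) hl fun n _ => Dpr_succ _ n, sum_univ_eq_sum_pad]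
  refine Finset.sum_congr rfl fun n hn => trade_eq hFinv1 _ (hl n ?_)
  rw [Finset.mem_range] at hn
  omega

end Dynamics

section Lagrangian

variable {f ρ lam : ℝ → ℝ} {t : ℕ → ℝ} {N : ℕ}

theorem hP_eq_hPeriod (i : ℕ) :
    hP f ρ lam t i = hPeriod f (aC ρ t i) (aC ρ t i * (lam (t i) / lam (t (i - 1)))) := by
  ext x
  simp only [hP, hPeriod, aH, mul_div_assoc]

theorem periodSum_sub_mul (ν : ℝ) (K L : ℝ → ℝ) (z : ℕ → ℝ) (e : ℝ) :
    periodSum ρ lam t N K z e - ν * periodSum ρ lam t N L z e =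
      ∑ i ∈ Finset.range N, lam (t i) * (K (z (i + 1) / aC ρ t (i + 1)) -
        lam (t (i + 1)) / lam (t i) * K (z (i + 1)) - ν * (L (z (i + 1) / aC ρ t (i + 1)) -
        lam (t (i + 1)) / lam (t i) * L (z (i + 1)))) + lam (t N) * (K e - ν * L e) := by
  have : ∀ A B C D : ℝ, A + B - ν * (C + D) = (A - ν * C) + (B - ν * D) := by intros; ring
  rw [periodSum, periodSum, this, Finset.mul_sum, ← Finset.sum_sub_distrib]
  congr 1
  · exact Finset.sum_congr rfl fun i _ => by ring
  · ring

theorem period_lagrangian_lt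
    (hf : Continuous f) (hl : ∀ n ≤ N, 0 < lam (t n))
    (hmono : ∀ i < N, StrictMono (hP f ρ lam t (i + 1)))
    (hden : ∀ i < N, ∀ x, 0 < f (x / aC ρ t (i + 1)) -
      aC ρ t (i + 1) * (lam (t (i + 1)) / lam (t i)) * f x)
    {ν : ℝ} {z : ℕ → ℝ} (hz : ∀ i < N, hP f ρ lam t (i + 1) (z (i + 1)) = ν)
    {i : ℕ} (hi : i < N) {y : ℝ} (hy : y ≠ z (i + 1)) :
    lam (t i) * (Ftil f (z (i + 1) / aC ρ t (i + 1)) -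
        lam (t (i + 1)) / lam (t i) * Ftil f (z (i + 1)) -
        ν * (Fint f (z (i + 1) / aC ρ t (i + 1)) -
        lam (t (i + 1)) / lam (t i) * Fint f (z (i + 1)))) <
      lam (t i) * (Ftil f (y / aC ρ t (i + 1)) - lam (t (i + 1)) / lam (t i) * Ftil f y -
        ν * (Fint f (y / aC ρ t (i + 1)) - lam (t (i + 1)) / lam (t i) * Fint f y)) := by
  refine mul_lt_mul_of_pos_left ?_ (hl i hi.le)
  exact lt_of_hasDerivAt_sub_mul (u := fun z => Ftil f (z / aC ρ t (i + 1)) -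
      lam (t (i + 1)) / lam (t i) * Ftil f z - ν * (Fint f (z / aC ρ t (i + 1)) -
      lam (t (i + 1)) / lam (t i) * Fint f z)) (hmono i hi)
    (fun x => mul_pos (one_div_pos.2 aC_pos) (hden i hi x))
    (fun x => by
      rw [hP_eq_hPeriod]
      exact hasDerivAt_lagrangian hf aC_pos (hden i hi) ν x) (hz i hi) hy

theorem period_lagrangian_le
    (hf : Continuous f) (hl : ∀ n ≤ N, 0 < lam (t n))
    (hmono : ∀ i < N, StrictMono (hP f ρ lam t (i + 1)))
    (hden : ∀ i < N, ∀ x, 0 < f (x / aC ρ t (i + 1)) -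
      aC ρ t (i + 1) * (lam (t (i + 1)) / lam (t i)) * f x)
    {ν : ℝ} {z : ℕ → ℝ} (hz : ∀ i < N, hP f ρ lam t (i + 1) (z (i + 1)) = ν)
    {i : ℕ} (hi : i < N) (y : ℝ) :
    lam (t i) * (Ftil f (z (i + 1) / aC ρ t (i + 1)) -
        lam (t (i + 1)) / lam (t i) * Ftil f (z (i + 1)) -
        ν * (Fint f (z (i + 1) / aC ρ t (i + 1)) -
        lam (t (i + 1)) / lam (t i) * Fint f (z (i + 1)))) ≤
      lam (t i) * (Ftil f (y / aC ρ t (i + 1)) - lam (t (i + 1)) / lam (t i) * Ftil f y -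
        ν * (Fint f (y / aC ρ t (i + 1)) - lam (t (i + 1)) / lam (t i) * Fint f y)) := by
  rcases eq_or_ne y (z (i + 1)) with rfl | hy
  · exact le_rfl
  · exact (period_lagrangian_lt hf hl hmono hden hz hi hy).le

theorem lagrangian_le
    (hf : Continuous f) (hfpos : ∀ x, 0 < f x) (hl : ∀ n ≤ N, 0 < lam (t n))
    (hmono : ∀ i < N, StrictMono (hP f ρ lam t (i + 1)))
    (hden : ∀ i < N, ∀ x, 0 < f (x / aC ρ t (i + 1)) -
      aC ρ t (i + 1) * (lam (t (i + 1)) / lam (t i)) * f x)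
    {ν : ℝ} {z : ℕ → ℝ} (hz : ∀ i < N, hP f ρ lam t (i + 1) (z (i + 1)) = ν)
    (y : ℕ → ℝ) (e : ℝ) :
    periodSum ρ lam t N (Ftil f) z ν - ν * periodSum ρ lam t N (Fint f) z ν ≤
      periodSum ρ lam t N (Ftil f) y e - ν * periodSum ρ lam t N (Fint f) y e := by
  rw [periodSum_sub_mul, periodSum_sub_mul]
  refine add_le_add (Finset.sum_le_sum fun i hi =>
    period_lagrangian_le hf hl hmono hden hz (Finset.mem_range.1 hi) _)
    (mul_le_mul_of_nonneg_left ?_ (hl N le_rfl).le)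
  exact le_of_hasDerivAt_sub_mul strictMono_id hfpos
    (hasDerivAt_terminal_lagrangian hf ν) rfl e

theorem eq_of_lagrangian_le
    (hf : Continuous f) (hfpos : ∀ x, 0 < f x) (hl : ∀ n ≤ N, 0 < lam (t n))
    (hmono : ∀ i < N, StrictMono (hP f ρ lam t (i + 1)))
    (hden : ∀ i < N, ∀ x, 0 < f (x / aC ρ t (i + 1)) -
      aC ρ t (i + 1) * (lam (t (i + 1)) / lam (t i)) * f x)
    {ν : ℝ} {z : ℕ → ℝ} (hz : ∀ i < N, hP f ρ lam t (i + 1) (z (i + 1)) = ν)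
    {y : ℕ → ℝ} {e : ℝ}
    (hle : periodSum ρ lam t N (Ftil f) y e - ν * periodSum ρ lam t N (Fint f) y e ≤
      periodSum ρ lam t N (Ftil f) z ν - ν * periodSum ρ lam t N (Fint f) z ν) :
    (∀ i < N, y (i + 1) = z (i + 1)) ∧ e = ν := by
  have hN : ∀ e, Ftil f ν - ν * Fint f ν ≤ Ftil f e - ν * Fint f e :=
    le_of_hasDerivAt_sub_mul strictMono_id hfpos (hasDerivAt_terminal_lagrangian hf ν) rfl
  rw [periodSum_sub_mul, periodSum_sub_mul] at hle
  constructor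
  · intro i hi
    by_contra hne
    refine hle.not_gt (add_lt_add_of_lt_of_le (Finset.sum_lt_sum (fun j hj =>
      period_lagrangian_le hf hl hmono hden hz (Finset.mem_range.1 hj) _)
      ⟨i, Finset.mem_range.2 hi, period_lagrangian_lt hf hl hmono hden hz hi hne⟩)
      (mul_le_mul_of_nonneg_left (hN e) (hl N le_rfl).le))
  · by_contra hne
    refine hle.not_gt (add_lt_add_of_le_of_lt (Finset.sum_le_sum fun j hj =>
      period_lagrangian_le hf hl hmono hden hz (Finset.mem_range.1 hj) _)
      (mul_lt_mul_of_pos_left ?_ (hl N le_rfl)))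
    exact lt_of_hasDerivAt_sub_mul strictMono_id hfpos
      (hasDerivAt_terminal_lagrangian hf ν) rfl hne

end Lagrangian

theorem exists_strictMono_inverse {h : ℝ → ℝ} (hmono : StrictMono h)
    (hsurj : Function.Surjective h) (h0 : h 0 = 0) :
    ∃ g : ℝ → ℝ, (∀ y, h (g y) = y) ∧ StrictMono g ∧ Continuous g ∧ g 0 = 0 := by
  let o := hmono.orderIsoOfSurjective h hsurj
  have ho : ∀ y, h (o.symm y) = y := fun y => o.apply_symm_apply y
  exact ⟨o.symm, ho, o.symm.strictMono, o.symm.continuous, hmono.injective (by rw [ho, h0])⟩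

section Volume

variable {f ρ lam : ℝ → ℝ} {t : ℕ → ℝ} {N : ℕ} {g : ℕ → ℝ → ℝ}

theorem periodSum_Fint_zero (hg0 : ∀ i < N, g (i + 1) 0 = 0) :
    periodSum ρ lam t N (Fint f) (fun i => g i 0) 0 = 0 := by
  rw [periodSum, Fint_zero, mul_zero, add_zero]
  refine Finset.sum_eq_zero fun i hi => ?_
  rw [hg0 i (Finset.mem_range.1 hi), zero_div, Fint_zero]
  ring

theorem monotone_sum_volume
    (hf : Continuous f) (hl : ∀ n ≤ N, 0 < lam (t n))
    (hden : ∀ i < N, ∀ x, 0 < f (x / aC ρ t (i + 1)) -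
      aC ρ t (i + 1) * (lam (t (i + 1)) / lam (t i)) * f x)
    (hg : ∀ i < N, StrictMono (g (i + 1))) :
    Monotone fun ν => ∑ i ∈ Finset.range N, lam (t i) *
      (Fint f (g (i + 1) ν / aC ρ t (i + 1)) -
        lam (t (i + 1)) / lam (t i) * Fint f (g (i + 1) ν)) := by
  refine fun μ ν hμν => Finset.sum_le_sum fun i hi => ?_
  rw [Finset.mem_range] at hi
  exact mul_le_mul_of_nonneg_left
    ((strictMono_volume hf aC_pos (hden i hi)).monotone ((hg i hi).monotone hμν)) (hl i hi.le).le

theorem strictMono_periodSum_Fint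
    (hf : Continuous f) (hl : ∀ n ≤ N, 0 < lam (t n))
    (hden : ∀ i < N, ∀ x, 0 < f (x / aC ρ t (i + 1)) -
      aC ρ t (i + 1) * (lam (t (i + 1)) / lam (t i)) * f x)
    (hg : ∀ i < N, StrictMono (g (i + 1)))
    (hfpos : ∀ x, 0 < f x) :
    StrictMono fun ν => periodSum ρ lam t N (Fint f) (fun i => g i ν) ν := fun _ _ hμν =>
  add_lt_add_of_le_of_lt (monotone_sum_volume hf hl hden hg hμν.le)
    (mul_lt_mul_of_pos_left (strictMono_Fint hf hfpos hμν) (hl N le_rfl))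

theorem surjective_periodSum_Fint
    (hf : Continuous f) (hl : ∀ n ≤ N, 0 < lam (t n))
    (hden : ∀ i < N, ∀ x, 0 < f (x / aC ρ t (i + 1)) -
      aC ρ t (i + 1) * (lam (t (i + 1)) / lam (t i)) * f x)
    (hg : ∀ i < N, StrictMono (g (i + 1)))
    (hFbot : Tendsto (Fint f) atBot atBot)
    (hFtop : Tendsto (Fint f) atTop atTop) (hgc : ∀ i < N, Continuous (g (i + 1))) :
    Function.Surjective fun ν => periodSum ρ lam t N (Fint f) (fun i => g i ν) ν := by
  have hF : Continuous (Fint f) :=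
    continuous_iff_continuousAt.2 fun x => (hasDerivAt_Fint hf x).continuousAt
  have hmono := monotone_sum_volume hf hl hden hg
  have hN := hl N le_rfl
  refine Continuous.surjective ?_ ?_ ?_
  · refine (continuous_finsetSum _ fun i hi => ?_).add (continuous_const.mul hF)
    have := hgc i (Finset.mem_range.1 hi)
    fun_prop
  · exact tendsto_atTop_add_left_of_le' _ _
      ((eventually_ge_atTop 0).mono fun ν hν => hmono hν) (hFtop.const_mul_atTop hN)
  · exact tendsto_atBot_add_left_of_ge' _ _
      ((eventually_le_atBot 0).mono fun ν hν => hmono hν) (hFbot.const_mul_atBot hN)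

end Volume

theorem stmt15 (f ρ lam Finv : ℝ → ℝ)
    (hf : ContDiff ℝ 1 f) (hfpos : ∀ x, 0 < f x)
    (hFbot : Tendsto (Fint f) atBot atBot) (hFtop : Tendsto (Fint f) atTop atTop)
    (hFinv1 : ∀ y, Fint f (Finv y) = y) (hFinv2 : ∀ y, Finv (Fint f y) = y)
    (hfanti : AntitoneOn f (Set.Iic 0)) (hfmono : MonotoneOn f (Set.Ici 0))
    (hr1 : MonotoneOn (fun x => x * deriv f x / f x) (Set.Iic 0))
    (hr2 : AntitoneOn (fun x => x * deriv f x / f x) (Set.Ici 0))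
    (hρ : ContDiff ℝ 1 ρ) (hρpos : ∀ s, 0 ≤ s → 0 < ρ s)
    (hlam : ContDiff ℝ 2 lam) (hlampos : ∀ s, 0 ≤ s → 0 < lam s)
    (hres : ∀ s, 0 ≤ s → deriv lam s / lam s < ρ s)
    (N : ℕ) (hN : 1 ≤ N) (t : ℕ → ℝ) (ht0 : t 0 = 0)
    (htmono : ∀ i, i < N → t i < t (i + 1)) :
    (∀ ξ : Fin (N + 1) → ℝ, 0 ≤ CPg f ρ lam Finv N t ξ) ∧
    ∀ x : ℝ, ∃ ν : ℝ, ∃ z : ℕ → ℝ,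
      (∀ i, 1 ≤ i → i ≤ N → hP f ρ lam t i (z i) = ν) ∧
      ((∑ i ∈ Finset.Icc 1 N, lam (t (i - 1)) *
          (Fint f (z i / aC ρ t i) - (lam (t i) / lam (t (i - 1))) * Fint f (z i))) +
          lam (t N) * Fint f ν = -x) ∧
      (∀ ν' : ℝ, ∀ z' : ℕ → ℝ, (∀ i, 1 ≤ i → i ≤ N → hP f ρ lam t i (z' i) = ν') →
        (∑ i ∈ Finset.Icc 1 N, lam (t (i - 1)) *
          (Fint f (z' i / aC ρ t i) - (lam (t i) / lam (t (i - 1))) * Fint f (z' i))) +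
          lam (t N) * Fint f ν' = -x → ν' = ν) ∧
      ∀ ξstar : Fin (N + 1) → ℝ,
        (∀ i : Fin (N + 1), ξstar i =
          if i.val = 0 then lam (t 0) * Fint f (z 1 / aC ρ t 1)
          else if i.val = N then lam (t N) * (Fint f ν - Fint f (z N))
          else lam (t i.val) * (Fint f (z (i.val + 1) / aC ρ t (i.val + 1)) -
            Fint f (z i.val))) →
        (∑ i, ξstar i = -x) ∧
        (∀ ξ : Fin (N + 1) → ℝ, ∑ i, ξ i = -x →
          CPg f ρ lam Finv N t ξstar ≤ CPg f ρ lam Finv N t ξ) ∧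
        (∀ ξ : Fin (N + 1) → ℝ, ∑ i, ξ i = -x → ξ ≠ ξstar →
          CPg f ρ lam Finv N t ξstar < CPg f ρ lam Finv N t ξ) ∧
        0 ≤ -x * ξstar 0 ∧ 0 ≤ -x * ξstar (Fin.last N) := by
  have hfc := hf.continuous
  have htn : ∀ n ≤ N, 0 ≤ t n := by
    intro n
    induction n with
    | zero => intro _; exact ht0.ge
    | succ n ih => intro hn; exact (ih (by omega)).trans (htmono n (by omega)).le
  have hl : ∀ n ≤ N, 0 < lam (t n) := fun n hn => hlampos _ (htn n hn)
  have hl' : ∀ n ≤ N, lam (t n) ≠ 0 := fun n hn => (hl n hn).ne'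
  have ha1 : ∀ i < N, aC ρ t (i + 1) < 1 := fun i hi =>
    aC_lt_one hρ.continuous hρpos (htn i hi.le) (htmono i hi)
  have hb1 : ∀ i < N, aC ρ t (i + 1) * (lam (t (i + 1)) / lam (t i)) < 1 := fun i hi => by
    rw [← mul_div_assoc]
    exact aH_lt_one hρ.continuous (hlam.differentiable two_ne_zero) hlampos hres
      (htn i hi.le) (htmono i hi)
  have hden : ∀ i < N, ∀ x, 0 < f (x / aC ρ t (i + 1)) -
      aC ρ t (i + 1) * (lam (t (i + 1)) / lam (t i)) * f x := fun i hi x =>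
    period_denom_pos hfpos hfanti hfmono aC_pos (ha1 i hi) (hb1 i hi) x
  have hmono : ∀ i < N, StrictMono (hP f ρ lam t (i + 1)) := fun i hi => by
    rw [hP_eq_hPeriod]
    exact strictMono_hPeriod hf hfpos hr1 hr2 aC_pos (ha1 i hi)
      (mul_pos aC_pos (div_pos (hl (i + 1) hi) (hl i hi.le))) (hden i hi)
  have hsurj : ∀ i < N, Function.Surjective (hP f ρ lam t (i + 1)) := fun i hi => by
    rw [hP_eq_hPeriod]
    exact surjective_hPeriod hfc hfpos aC_pos (ha1 i hi) (hden i hi)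
  have hP0 : ∀ i, hP f ρ lam t i 0 = 0 := fun i => by rw [hP_eq_hPeriod, hPeriod_zero]
  refine ⟨fun ξ => ?_, fun x => ?_⟩
  · have := lagrangian_le hfc hfpos hl hmono hden (ν := 0) (z := fun _ => 0)
      (fun i _ => hP0 (i + 1)) (Dpr f ρ lam Finv t (pad ξ))
      (postImpact f ρ lam Finv t (pad ξ) N)
    rw [CPg_eq_periodSum hFinv2 hl']
    simpa [periodSum, Ftil_zero] using this
  have hinv : ∀ i, ∃ g : ℝ → ℝ, 1 ≤ i → i ≤ N → (∀ y, hP f ρ lam t i (g y) = y) ∧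
      StrictMono g ∧ Continuous g ∧ g 0 = 0 := fun i => by
    by_cases hi : 1 ≤ i ∧ i ≤ N
    · obtain ⟨j, rfl⟩ := Nat.exists_eq_add_of_le' hi.1
      obtain ⟨g, hg⟩ := exists_strictMono_inverse (hmono j hi.2) (hsurj j hi.2) (hP0 _)
      exact ⟨g, fun _ _ => hg⟩
    · exact ⟨id, fun h1 h2 => absurd ⟨h1, h2⟩ hi⟩
  choose g hg using hinv
  have hgmono : ∀ i < N, StrictMono (g (i + 1)) := fun i hi => (hg (i + 1) (by omega) hi).2.1
  have hg0 : ∀ i < N, g (i + 1) 0 = 0 := fun i hi => (hg (i + 1) (by omega) hi).2.2.2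
  have hSmono := strictMono_periodSum_Fint hfc hl hden hgmono hfpos
  obtain ⟨ν, hν⟩ := surjective_periodSum_Fint hfc hl hden hgmono hFbot hFtop
    (fun i hi => (hg (i + 1) (by omega) hi).2.2.1) (-x)
  have hsum : ∀ (z : ℕ → ℝ) (ν : ℝ), (∑ i ∈ Finset.Icc 1 N, lam (t (i - 1)) *
      (Fint f (z i / aC ρ t i) - (lam (t i) / lam (t (i - 1))) * Fint f (z i))) +
      lam (t N) * Fint f ν = periodSum ρ lam t N (Fint f) z ν := fun z ν => by
    rw [sum_Icc_one_eq_sum_range]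
    rfl
  have hz : ∀ i < N, hP f ρ lam t (i + 1) (g (i + 1) ν) = ν := fun i hi =>
    (hg (i + 1) (by omega) hi).1 ν
  refine ⟨ν, fun i => g i ν, fun i h1 h2 => (hg i h1 h2).1 ν, (hsum _ _).trans hν, ?_, ?_⟩
  · intro ν' z' hz' hs'
    rw [hsum] at hs'
    refine hSmono.injective ((hs'.symm.trans ?_).symm.trans hν.symm)
    refine congrArg (· + _) (Finset.sum_congr rfl fun i hi => ?_)
    rw [Finset.mem_range] at hi
    have : z' (i + 1) = g (i + 1) ν' := (hmono i hi).injective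
      ((hz' _ (by omega) hi).trans ((hg (i + 1) (by omega) hi).1 ν').symm)
    simp only [this]
  intro ξs hξs
  have hpad : ∀ n (hn : n < N + 1), pad ξs n = ξs ⟨n, hn⟩ := fun n hn => dif_pos hn
  have hD : ∀ n ≤ N, Dpr f ρ lam Finv t (pad ξs) n = if n = 0 then 0 else g n ν := by
    refine Dpr_eq hFinv2 hl' (if_pos rfl) fun n hn => ?_
    rw [hpad n (by omega), hξs]
    rcases Nat.eq_zero_or_pos n with rfl | hn0
    · simp [Fint_zero]
    · simp [hn0.ne', hn.ne]
  have hDN : Dpr f ρ lam Finv t (pad ξs) N = g N ν := by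
    rw [hD N le_rfl, if_neg (by omega)]
  have hlast : ξs (Fin.last N) = lam (t N) * (Fint f ν - Fint f (g N ν)) := by
    rw [hξs, if_neg (by simp only [Fin.val_last]; omega), if_pos (Fin.val_last N)]
  have hE : postImpact f ρ lam Finv t (pad ξs) N = ν :=
    postImpact_eq hFinv2 (hl' N le_rfl) (by rw [hDN, ← hlast, hpad N (by omega)]; rfl)
  have hDs : ∀ i < N, Dpr f ρ lam Finv t (pad ξs) (i + 1) = g (i + 1) ν := fun i hi => by
    rw [hD _ hi, if_neg (by omega)]
  have hKs : ∀ K : ℝ → ℝ, periodSum ρ lam t N K (Dpr f ρ lam Finv t (pad ξs))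
      (postImpact f ρ lam Finv t (pad ξs) N) =
      periodSum ρ lam t N K (fun i => g i ν) ν := fun K => by
    rw [hE]
    refine congrArg (· + _) (Finset.sum_congr rfl fun i hi => ?_)
    rw [hDs i (Finset.mem_range.1 hi)]
  have hle : ∀ ξ : Fin (N + 1) → ℝ, ∑ i, ξ i = -x →
      CPg f ρ lam Finv N t ξs ≤ CPg f ρ lam Finv N t ξ := fun ξ hξ => by
    rw [sum_eq_periodSum hFinv1 hl'] at hξ
    rw [CPg_eq_periodSum hFinv2 hl', CPg_eq_periodSum hFinv2 hl', hKs]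
    have := lagrangian_le hfc hfpos hl hmono hden (z := fun i => g i ν) hz
      (Dpr f ρ lam Finv t (pad ξ)) (postImpact f ρ lam Finv t (pad ξ) N)
    rw [hξ] at this
    simp only at hν
    rw [hν] at this
    linarith
  refine ⟨by rw [sum_eq_periodSum hFinv1 hl', hKs]; exact hν, hle, fun ξ hξ hne => ?_, ?_⟩
  · refine lt_of_le_of_ne (hle ξ hξ) fun heq => hne ?_
    rw [sum_eq_periodSum hFinv1 hl'] at hξ
    rw [CPg_eq_periodSum hFinv2 hl', CPg_eq_periodSum hFinv2 hl', hKs] at heq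
    obtain ⟨hDeq, hEeq⟩ := eq_of_lagrangian_le hfc hfpos hl hmono hden
      (z := fun i => g i ν) hz (y := Dpr f ρ lam Finv t (pad ξ))
      (e := postImpact f ρ lam Finv t (pad ξ) N) (by simp only at hν; rw [hξ, hν, heq])
    have hDall : ∀ n ≤ N, Dpr f ρ lam Finv t (pad ξ) n = Dpr f ρ lam Finv t (pad ξs) n := by
      rintro (_ | n) hn
      · rw [Dpr, Dpr]
      · rw [hDeq n hn, hDs n hn]
    have hEall : ∀ n ≤ N, postImpact f ρ lam Finv t (pad ξ) n =
        postImpact f ρ lam Finv t (pad ξs) n := fun n hn => by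
      rcases hn.lt_or_eq with hn | rfl
      · have := hDall (n + 1) hn
        rw [Dpr_succ, Dpr_succ] at this
        exact mul_left_cancel₀ aC_pos.ne' this
      · rw [hEeq, hE]
    ext i
    have hi : i.val ≤ N := Nat.le_of_lt_succ i.2
    rw [← hpad i.val i.2, show ξ i = pad ξ i.val by rw [pad, dif_pos i.2],
      trade_eq hFinv1 (pad ξ) (hl' _ hi), trade_eq hFinv1 (pad ξs) (hl' _ hi),
      hDall _ hi, hEall _ hi]
  have hFmono := strictMono_Fint hfc hfpos
  have hfirst : ξs 0 = lam (t 0) * Fint f (g 1 ν / aC ρ t 1) := by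
    rw [hξs, if_pos (Fin.val_zero _)]
  obtain ⟨m, rfl⟩ := Nat.exists_eq_add_of_le' hN
  have hS0 := periodSum_Fint_zero (f := f) (ρ := ρ) (lam := lam) (t := t) hg0
  have hgN := hz m m.lt_succ_self
  rw [hP_eq_hPeriod] at hgN
  have hm := m.lt_succ_self
  rw [hfirst, hlast, ← hν]
  rcases le_total 0 ν with h | h
  · have hS := hSmono.monotone h
    have h1 : 0 ≤ g 1 ν := by
      rw [← hg0 0 (by omega)]; exact (hgmono 0 (by omega)).monotone h
    have h2 : 0 ≤ g (m + 1) ν := by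
      rw [← hg0 m hm]; exact (hgmono m hm).monotone h
    have h3 := le_hPeriod hfpos aC_pos (ha1 m hm) (hden m hm) h2
    have h4 := hFmono.monotone (div_nonneg h1 (aC_pos (ρ := ρ) (t := t) (i := 1)).le)
    rw [Fint_zero] at h4
    rw [hS0] at hS
    exact ⟨mul_nonneg hS (mul_nonneg (hl 0 (by omega)).le h4),
      mul_nonneg hS (mul_nonneg (hl _ le_rfl).le
        (sub_nonneg.2 (hFmono.monotone (h3.trans hgN.le))))⟩
  · have hS := hSmono.monotone h
    have h1 : g 1 ν ≤ 0 := by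
      rw [← hg0 0 (by omega)]; exact (hgmono 0 (by omega)).monotone h
    have h2 : g (m + 1) ν ≤ 0 := by
      rw [← hg0 m hm]; exact (hgmono m hm).monotone h
    have h3 := hPeriod_le hfpos aC_pos (ha1 m hm) (hden m hm) h2
    have h4 := hFmono.monotone
      (div_nonpos_of_nonpos_of_nonneg h1 (aC_pos (ρ := ρ) (t := t) (i := 1)).le)
    rw [Fint_zero] at h4
    rw [hS0] at hS
    exact ⟨mul_nonneg_of_nonpos_of_nonpos hS
        (mul_nonpos_of_nonneg_of_nonpos (hl 0 (by omega)).le h4),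
      mul_nonneg_of_nonpos_of_nonpos hS (mul_nonpos_of_nonneg_of_nonpos (hl _ le_rfl).le
        (sub_nonpos.2 (hFmono.monotone (hgN.ge.trans h3))))⟩
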